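/- For all integers n and k with k ≥ 3 and 2^k ≤ n/3: if n balls are thrown independently and uniformly at random into k·2^k bins, then the probability that at most 2^k bins are occupied is at most e^{n/3}·k^{−2n/3}, which in turn is at most e^{−n/3}. -/

import Mathlib

open scoped Classical

/-- Union bound over the possible sets of `m` bins that contain all the balls. -/
theorem card_filter_card_image_le {α β : Type*} [Fintype α] [Fintype β] {m : ℕ}
    (hm : m ≤ Fintype.card β) :
    (Finset.univ.filter fun X : α → β => (Finset.univ.image X).card ≤ m).card ≤
      (Fintype.card β).choose m * m ^ Fintype.card α := by
  calc
    _ ≤ ((Finset.powersetCard m Finset.univ).biUnion fun S : Finset β =>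
          Fintype.piFinset fun _ : α => S).card := by
      refine Finset.card_le_card fun X hX => ?_
      obtain ⟨S, hXS, -, hS⟩ := Finset.exists_subsuperset_card_eq
        (Finset.subset_univ (Finset.univ.image X)) (Finset.mem_filter.1 hX).2 hm
      refine Finset.mem_biUnion.2 ⟨S, by simp [hS], Fintype.mem_piFinset.2 fun a => ?_⟩
      exact hXS (Finset.mem_image_of_mem X (Finset.mem_univ a))
    _ ≤ (Finset.powersetCard m (Finset.univ : Finset β)).card * m ^ Fintype.card α := by
      refine Finset.card_biUnion_le_card_mul _ _ _ fun S hS => ?_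
      simp [(Finset.mem_powersetCard.1 hS).2]
    _ = _ := by simp

theorem choose_mul_self_le_exp_mul_pow (k m : ℕ) :
    ((k * m).choose m : ℝ) ≤ (Real.exp 1 * k) ^ m := by
  calc
    ((k * m).choose m : ℝ) ≤ ((k * m : ℕ) : ℝ) ^ m / m.factorial := Nat.choose_le_pow_div m _
    _ = k ^ m * ((m : ℝ) ^ m / m.factorial) := by push_cast; ring
    _ ≤ k ^ m * Real.exp m := by
      gcongr
      exact Real.pow_div_factorial_le_exp m (by positivity) m
    _ = _ := by rw [mul_pow, ← Real.exp_nat_mul, mul_one, mul_comm]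

/-- For all integers `n` and `k` with `k ≥ 3` and `2^k ≤ n/3`: if `n` balls are thrown
independently and uniformly at random into `k · 2^k` bins (the outcome is
`X : Fin n → Fin (k · 2^k)` distributed according to the product of `n` copies of the
uniform distribution), then the probability that at most `2^k` bins are occupied (the
image of `X` has cardinality at most `2^k`) is at most `e^(n/3) · k^(-2n/3)`, which in
turn is at most `e^(-n/3)`. -/
theorem estimate_size_occupied_bins (n k : ℕ) (hk : 3 ≤ k)
    (h : (2 : ℝ) ^ k ≤ (n : ℝ) / 3) :
    ((Finset.univ.filter (fun X : Fin n → Fin (k * 2 ^ k) =>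
          (Finset.univ.image X).card ≤ 2 ^ k)).card : ℝ) / ((k * 2 ^ k : ℕ) : ℝ) ^ n
        ≤ Real.exp ((n : ℝ) / 3) * (k : ℝ) ^ (-(2 * (n : ℝ) / 3)) ∧
    Real.exp ((n : ℝ) / 3) * (k : ℝ) ^ (-(2 * (n : ℝ) / 3)) ≤ Real.exp (-(n : ℝ) / 3) := by
  have hk' : (3 : ℝ) ≤ k := by exact_mod_cast hk
  have hk0 : (0 : ℝ) < k := by linarith
  constructor
  · set m : ℕ := 2 ^ k with hm
    have hm0 : (0 : ℝ) < m := by rw [hm]; positivity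
    have hmn : (m : ℝ) ≤ n / 3 := by rw [hm]; exact_mod_cast h
    have hcard := card_filter_card_image_le (α := Fin n) (β := Fin (k * m)) (m := m)
      (by rw [Fintype.card_fin]; exact Nat.le_mul_of_pos_left m (by lia))
    rw [Fintype.card_fin, Fintype.card_fin] at hcard
    calc
      _ ≤ ((k * m).choose m * (m : ℝ) ^ n) / ((k * m : ℕ) : ℝ) ^ n := by
        gcongr
        refine le_trans (le_of_eq ?_) (Nat.cast_le.2 hcard |>.trans_eq (by push_cast; rfl))
        congr!
      _ ≤ ((Real.exp 1 * k) ^ m * (m : ℝ) ^ n) / ((k * m : ℕ) : ℝ) ^ n := by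
        gcongr
        exact choose_mul_self_le_exp_mul_pow k m
      _ = (Real.exp 1 * k) ^ (m : ℝ) / (k : ℝ) ^ n := by
        rw [Real.rpow_natCast]
        push_cast
        field_simp
        ring
      _ ≤ (Real.exp 1 * k) ^ ((n : ℝ) / 3) / (k : ℝ) ^ n := by
        gcongr
        nlinarith [Real.add_one_le_exp (1 : ℝ)]
      _ = Real.exp ((n : ℝ) / 3) * ((k : ℝ) ^ ((n : ℝ) / 3) / (k : ℝ) ^ (n : ℝ)) := by
        rw [Real.mul_rpow (Real.exp_pos 1).le hk0.le, Real.exp_one_rpow, Real.rpow_natCast,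
          mul_div_assoc]
      _ = _ := by
        rw [← Real.rpow_sub hk0]
        ring_nf
  · calc
      _ ≤ Real.exp ((n : ℝ) / 3) * Real.exp 1 ^ (-(2 * (n : ℝ) / 3)) := by
        have he : Real.exp 1 ≤ k := by linarith [Real.exp_one_lt_d9]
        exact mul_le_mul_of_nonneg_left (Real.rpow_le_rpow_of_nonpos (Real.exp_pos 1) he
          (neg_nonpos.2 (by positivity))) (Real.exp_pos _).le
      _ = _ := by
        rw [Real.exp_one_rpow, ← Real.exp_add]
        ring_nf
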